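/- In any execution of the AGS coding scheme Π (Algorithms 3–4) on inputs (x,y) with an arbitrary erasure pattern, for every round i ≥ 1: (1) r_A(i+1) ∈ {r_A(i), r_A(i)+1} and T^A(i+1) ∈ {T^A(i), T^A(i)∘π(x|T^A(i))∘b_B(i)}; (2) r_B(i+1) ∈ {r_B(i), r_B(i)+1} and T^B(i+1) ∈ {T^B(i), T^B(i)∘b_A(i)∘π(y|T^B(i)∘b_A(i))}. Furthermore, r_A(i+1) = r_A(i)+1 if and only if T^A(i+1) ≠ T^A(i), and r_B(i+1) = r_B(i)+1 if and only if T^B(i+1) ≠ T^B(i). -/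

import Mathlib

/-!
Model of the AGS coding scheme Π (Algorithms 3–4) of "Interactive coding resilient to
an unknown number of erasures".  A noiseless alternating binary protocol `π` of length
`N` is given by next-bit functions `fA fB : List Bool → Bool` (`fA t = π(x∣t)` on
even-length transcripts, `fB t = π(y∣t)` on odd-length transcripts).
Rounds are 1-indexed; round `i` consists of two timesteps whose erasures are given by
`(E i).1` (odd timestep, Alice → Bob) and `(E i).2` (even timestep, Bob → Alice).
In each timestep the sender either transmits a symbol `(b, ρ) ∈ {0,1}×{0,1}` or stays
silent (`□`); a reception is `none` (= the erasure mark ⊥) or `some` of a symbol.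
-/

namespace AGS

/-- A transmitted symbol: a message `(bit, parity)`, or silence `□`. -/
inductive Sym where
  | msg : Bool → Bool → Sym
  | sil : Sym
deriving DecidableEq

/-- The word (information-bit content) of a symbol: one bit for a message, the empty
word for silence. -/
def symWord : Sym → List Bool
  | Sym.msg b _ => [b]
  | Sym.sil => []

/-- Parity of a round number, as a Boolean. -/
def par (r : ℕ) : Bool := decide (r % 2 = 1)

/-- Joint state at the beginning of a round: Alice's transcript `TA`, counter `rA`,
flag `abot` (her last reception was ⊥); Bob's transcript `TB`, counter `rB`, and
stored bit `bsend`. -/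
structure St where
  TA : List Bool
  rA : ℕ
  abot : Bool
  TB : List Bool
  rB : ℕ
  bsend : Bool
deriving DecidableEq

/-- The initial state. -/
def init : St := ⟨[], 0, false, [], 0, false⟩

/-- The symbol Alice sends in the odd timestep of a round (silence if her last
reception was erased, and implicit silence after she has terminated). -/
def sentA (fA : List Bool → Bool) (N : ℕ) (s : St) : Sym :=
  if s.rA < N / 2 then
    if s.abot then Sym.sil else Sym.msg (fA s.TA) (par (s.rA + 1))
  else Sym.sil

/-- Bob's reception in the odd timestep (`none` = erasure mark ⊥). -/
def recvB (fA : List Bool → Bool) (N : ℕ) (e1 : Bool) (s : St) : Option Sym :=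
  if e1 then none else some (sentA fA N s)

/-- Bob's update of `TB, rB, bsend` in the odd timestep, given his reception. -/
def bobUpd (fB : List Bool → Bool) (N : ℕ) (r : Option Sym) (s : St) : St :=
  if s.rB < N / 2 then
    match r with
    | some (Sym.msg b p) =>
        if p = par (s.rB + 1) then
          { s with rB := s.rB + 1, bsend := fB (s.TB ++ [b]),
                   TB := (s.TB ++ [b]) ++ [fB (s.TB ++ [b])] }
        else s
    | _ => s
  else s

/-- The symbol Bob sends in the even timestep of a round, given the erasure `e1` of
the odd timestep and the state `s` at the beginning of the round.  In the normal
phase (`rB < N/2`) he answers any non-⊥ reception with his (possibly just updated)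
stored message and is silent upon ⊥; in the termination phase (`rB = N/2`) he answers
only a non-silent message of matching parity, and is silent otherwise. -/
def sentB (fA fB : List Bool → Bool) (N : ℕ) (e1 : Bool) (s : St) : Sym :=
  let r := recvB fA N e1 s
  if s.rB < N / 2 then
    match r with
    | none => Sym.sil
    | some _ =>
        let s' := bobUpd fB N r s
        Sym.msg s'.bsend (par s'.rB)
  else
    match r with
    | some (Sym.msg _ p) => if p = par s.rB then Sym.msg s.bsend (par s.rB) else Sym.sil
    | _ => Sym.sil

/-- One round of the AGS coding scheme.  After Alice terminates (`rA = N/2`) her part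
of the state is frozen and only Bob's part evolves (he keeps receiving silence, unless
erased). -/
def step (fA fB : List Bool → Bool) (N : ℕ) (e : Bool × Bool) (s : St) : St :=
  let r := recvB fA N e.1 s
  let sB := bobUpd fB N r s
  if s.rA < N / 2 then
    let mB := sentB fA fB N e.1 s
    let rcvA : Option Sym := if e.2 then none else some mB
    match rcvA with
    | none => { sB with rA := s.rA, abot := true }
    | some (Sym.msg b p) =>
        if p = par (s.rA + 1) then
          { sB with TA := (s.TA ++ [fA s.TA]) ++ [b], rA := s.rA + 1, abot := false }
        else { sB with rA := s.rA, abot := false }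
    | some Sym.sil => { sB with rA := s.rA, abot := false }
  else sB

/-- `exec fA fB N E k` is the state after `k` rounds have been played. -/
def exec (fA fB : List Bool → Bool) (N : ℕ) (E : ℕ → Bool × Bool) : ℕ → St
  | 0 => init
  | k + 1 => step fA fB N (E (k + 1)) (exec fA fB N E k)

/-- `stAt fA fB N E i` is the state at the beginning of round `i` (rounds 1-indexed):
for a protocol variable `v`, `v(i) = (stAt … i).v`. -/
def stAt (fA fB : List Bool → Bool) (N : ℕ) (E : ℕ → Bool × Bool) (i : ℕ) : St :=
  exec fA fB N E (i - 1)

/-- The noiseless transcript of `π` after `r` rounds; `transcript fA fB (N/2)` is `T^π`. -/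
def transcript (fA fB : List Bool → Bool) : ℕ → List Bool
  | 0 => []
  | r + 1 =>
    let t := transcript fA fB r
    (t ++ [fA t]) ++ [fB (t ++ [fA t])]

/-- `cA … i` : the number of rounds `j < i` in which Alice sent a non-silent message. -/
def cA (fA fB : List Bool → Bool) (N : ℕ) (E : ℕ → Bool × Bool) (i : ℕ) : ℕ :=
  ((Finset.Ico 1 i).filter fun j => sentA fA N (stAt fA fB N E j) ≠ Sym.sil).card

/-- `cB … i` : the number of rounds `j < i` in which Bob sent a non-silent message. -/
def cB (fA fB : List Bool → Bool) (N : ℕ) (E : ℕ → Bool × Bool) (i : ℕ) : ℕ :=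
  ((Finset.Ico 1 i).filter fun j =>
    sentB fA fB N (E j).1 (stAt fA fB N E j) ≠ Sym.sil).card

/-- `cch … i` : the total number of ⊥ receptions of Bob and of Alice in the rounds
before round `i` (Alice receives only while she is active). -/
def cch (fA fB : List Bool → Bool) (N : ℕ) (E : ℕ → Bool × Bool) (i : ℕ) : ℕ :=
  ((Finset.Ico 1 i).filter fun j => (E j).1 = true).card +
  ((Finset.Ico 1 i).filter fun j =>
    (E j).2 = true ∧ (stAt fA fB N E j).rA < N / 2).card

theorem stAt_succ (fA fB : List Bool → Bool) (N : ℕ) (E : ℕ → Bool × Bool) {i : ℕ}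
    (hi : 1 ≤ i) :
    stAt fA fB N E (i + 1) = step fA fB N (E i) (stAt fA fB N E i) := by
  obtain ⟨k, rfl⟩ := Nat.exists_eq_add_of_le' hi
  rfl

/-- Bob's update leaves Alice's variables alone, and either changes nothing or advances
Bob's counter and appends the received bit with its answer. -/
theorem bobUpd_cases (fB : List Bool → Bool) (N : ℕ) (r : Option Sym) (s : St) :
    bobUpd fB N r s = s ∨
      ∃ b p, r = some (Sym.msg b p) ∧ bobUpd fB N r s =
        { s with rB := s.rB + 1, bsend := fB (s.TB ++ [b]),
                 TB := (s.TB ++ [b]) ++ [fB (s.TB ++ [b])] } := by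
  unfold bobUpd
  split_ifs
  · split
    · split_ifs
      · exact Or.inr ⟨_, _, rfl, rfl⟩
      · exact Or.inl rfl
    · exact Or.inl rfl
  · exact Or.inl rfl

theorem step_bob (fA fB : List Bool → Bool) (N : ℕ) (e : Bool × Bool) (s : St) :
    (step fA fB N e s).rB = (bobUpd fB N (recvB fA N e.1 s) s).rB ∧
      (step fA fB N e s).TB = (bobUpd fB N (recvB fA N e.1 s) s).TB := by
  simp only [step]
  split_ifs <;> (try split) <;> (try split_ifs) <;> exact ⟨rfl, rfl⟩

theorem step_bob_cases (fA fB : List Bool → Bool) (N : ℕ) (e : Bool × Bool) (s : St) :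
    ((step fA fB N e s).rB = s.rB ∧ (step fA fB N e s).TB = s.TB) ∨
      ∃ b p, sentA fA N s = Sym.msg b p ∧ (step fA fB N e s).rB = s.rB + 1 ∧
        (step fA fB N e s).TB = (s.TB ++ [b]) ++ [fB (s.TB ++ [b])] := by
  obtain ⟨hr, hT⟩ := step_bob fA fB N e s
  rw [hr, hT]
  rcases bobUpd_cases fB N (recvB fA N e.1 s) s with h | ⟨b, p, hrecv, h⟩
  · exact Or.inl (by simp [h])
  · refine Or.inr ⟨b, p, ?_, by simp [h], by simp [h]⟩
    unfold recvB at hrecv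
    split_ifs at hrecv
    exact Option.some.inj hrecv

theorem step_alice_cases (fA fB : List Bool → Bool) (N : ℕ) (e : Bool × Bool) (s : St) :
    ((step fA fB N e s).rA = s.rA ∧ (step fA fB N e s).TA = s.TA) ∨
      ∃ b p, sentB fA fB N e.1 s = Sym.msg b p ∧ (step fA fB N e s).rA = s.rA + 1 ∧
        (step fA fB N e s).TA = (s.TA ++ [fA s.TA]) ++ [b] := by
  have hB : (bobUpd fB N (recvB fA N e.1 s) s).rA = s.rA ∧
      (bobUpd fB N (recvB fA N e.1 s) s).TA = s.TA := by
    rcases bobUpd_cases fB N (recvB fA N e.1 s) s with h | ⟨b, p, -, h⟩ <;> simp [h]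
  by_cases hA : s.rA < N / 2
  · rcases e with ⟨e₁, _ | _⟩ <;> rcases hm : sentB fA fB N e₁ s with ⟨b, p⟩ | _ <;>
      simp_all [step]
    split_ifs <;> simp
  · exact Or.inl (by simpa only [step, if_neg hA] using hB)

/-- Lemma 12 of the paper.  In any execution of the AGS scheme, in
every round `i ≥ 1` the counters increase by at most one, the transcripts either stay
put or get extended by the messages of the round, and a counter changes iff the
corresponding transcript changes. -/
theorem ags_round_progress
    (fA fB : List Bool → Bool) (N : ℕ) (hN : 0 < N) (hNeven : Even N)
    (E : ℕ → Bool × Bool) (i : ℕ) (hi : 1 ≤ i)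
    (s s' : St) (hs : s = stAt fA fB N E i) (hs' : s' = stAt fA fB N E (i + 1))
    (bAw bBw : List Bool)
    (hbA : bAw = symWord (sentA fA N s))
    (hbB : bBw = symWord (sentB fA fB N (E i).1 s)) :
    ((s'.rA = s.rA ∨ s'.rA = s.rA + 1) ∧
      (s'.TA = s.TA ∨ s'.TA = (s.TA ++ [fA s.TA]) ++ bBw)) ∧
    ((s'.rB = s.rB ∨ s'.rB = s.rB + 1) ∧
      (s'.TB = s.TB ∨ s'.TB = (s.TB ++ bAw) ++ [fB (s.TB ++ bAw)])) ∧
    (s'.rA = s.rA + 1 ↔ s'.TA ≠ s.TA) ∧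
    (s'.rB = s.rB + 1 ↔ s'.TB ≠ s.TB) := by
  rw [stAt_succ fA fB N E hi, ← hs] at hs'
  subst hs' hbA hbB
  refine ⟨?_, ?_, ?_, ?_⟩
  · rcases step_alice_cases fA fB N (E i) s with ⟨hr, hT⟩ | ⟨b, p, hm, hr, hT⟩
    · exact ⟨Or.inl hr, Or.inl hT⟩
    · exact ⟨Or.inr hr, Or.inr (by rw [hT, hm, symWord])⟩
  · rcases step_bob_cases fA fB N (E i) s with ⟨hr, hT⟩ | ⟨b, p, hm, hr, hT⟩
    · exact ⟨Or.inl hr, Or.inl hT⟩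
    · exact ⟨Or.inr hr, Or.inr (by rw [hT, hm, symWord])⟩
  · rcases step_alice_cases fA fB N (E i) s with ⟨hr, hT⟩ | ⟨b, p, -, hr, hT⟩ <;>
      simp [hr, hT]
  · rcases step_bob_cases fA fB N (E i) s with ⟨hr, hT⟩ | ⟨b, p, -, hr, hT⟩ <;>
      simp [hr, hT]

end AGS
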